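/- Let P₁, P₂, P₃ be affinely independent points in ℝ², let K be the triangle with these vertices, |K| its two-dimensional Lebesgue measure, e = [P₁, P₂] the edge of length |e| = dist(P₁, P₂), and h_K the diameter of K. Let u : ℝ² → ℝ be continuously differentiable on a neighborhood of K and satisfy the mean-zero condition on the edge ∫_e u ds = 0, where ∫_e g ds denotes the line integral ∫₀¹ g(P₁ + t(P₂ − P₁)) |e| dt. Then the trace inequality (∫_e u² ds)^{1/2} ≤ 0.574 · √(|e|/|K|) · h_K · (∫_K |∇u(x)|² dx)^{1/2} holds. -/

import Mathlib

open MeasureTheory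
open scoped RealInnerProductSpace

local notation "ℝ²" => EuclideanSpace ℝ (Fin 2)

/-- Wirtinger's inequality on `[0, 1]` for functions vanishing at both endpoints. -/
theorem sq_mul_integral_sq_le_of_eq_zero {κ : ℝ} (hκ : 0 < κ) (hκπ : κ < Real.pi)
    {G g : ℝ → ℝ} (hG : ∀ x, HasDerivAt G (g x) x) (hg : Continuous g)
    (h0 : G 0 = 0) (h1 : G 1 = 0) :
    κ ^ 2 * ∫ x in (0:ℝ)..1, G x ^ 2 ≤ ∫ x in (0:ℝ)..1, g x ^ 2 := by
  have hGc : Continuous G := continuous_iff_continuousAt.2 fun x => (hG x).continuousAt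
  set θ : ℝ → ℝ := fun x => κ * Real.tan (κ * (1 / 2 - x)) with hθ
  have hcos : ∀ x ∈ Set.uIcc (0:ℝ) 1, Real.cos (κ * (1 / 2 - x)) ≠ 0 := by
    intro x hx
    rw [Set.uIcc_of_le zero_le_one] at hx
    refine (Real.cos_pos_of_mem_Ioo ⟨?_, ?_⟩).ne' <;> nlinarith [hx.1, hx.2]
  have hθd : ∀ x ∈ Set.uIcc (0:ℝ) 1, HasDerivAt θ (-(κ ^ 2 + θ x ^ 2)) x := by
    intro x hx
    have hl : HasDerivAt (fun x : ℝ => κ * (1 / 2 - x)) (-κ) x := by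
      simpa using ((hasDerivAt_id x).const_sub (1 / 2 : ℝ)).const_mul κ
    have := ((Real.hasDerivAt_tan (hcos x hx)).comp x hl).const_mul κ
    refine this.congr_deriv ?_
    have hc := hcos x hx
    simp only [hθ, Real.tan_eq_sin_div_cos]
    generalize κ * (1 / 2 - x) = y at hc
    have h2 := Real.sin_sq_add_cos_sq y
    field_simp
    linear_combination h2
  have hθc : ContinuousOn θ (Set.uIcc 0 1) := fun x hx =>
    (hθd x hx).continuousAt.continuousWithinAt
  have hP : ∀ x ∈ Set.uIcc (0:ℝ) 1, HasDerivAt (fun x => G x ^ 2 * θ x)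
      (2 * G x * g x * θ x - G x ^ 2 * (κ ^ 2 + θ x ^ 2)) x := by
    intro x hx
    refine (((hG x).pow 2).mul (hθd x hx)).congr_deriv ?_
    simp
    ring
  have hPc : ContinuousOn (fun x => 2 * G x * g x * θ x - G x ^ 2 * (κ ^ 2 + θ x ^ 2))
      (Set.uIcc 0 1) := by
    have := hGc.continuousOn (s := Set.uIcc (0:ℝ) 1)
    have := hg.continuousOn (s := Set.uIcc (0:ℝ) 1)
    fun_prop
  have hzero := intervalIntegral.integral_eq_sub_of_hasDerivAt hP hPc.intervalIntegrable
  simp only [h0, h1] at hzero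
  have hle : ∫ x in (0:ℝ)..1, (2 * G x * g x * θ x - G x ^ 2 * (κ ^ 2 + θ x ^ 2)) ≤
      ∫ x in (0:ℝ)..1, (g x ^ 2 - κ ^ 2 * G x ^ 2) := by
    refine intervalIntegral.integral_mono_on zero_le_one hPc.intervalIntegrable
      ((by fun_prop : Continuous _).intervalIntegrable _ _) fun x _ => ?_
    nlinarith [sq_nonneg (g x - θ x * G x)]
  rw [hzero, intervalIntegral.integral_sub
    ((by fun_prop : Continuous _).intervalIntegrable _ _)
    ((by fun_prop : Continuous _).intervalIntegrable _ _),
    intervalIntegral.integral_const_mul] at hle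
  linarith

/-- Wirtinger's inequality on `[0, 1]` for functions of mean zero. -/
theorem sq_mul_integral_sq_le_of_integral_eq_zero {κ : ℝ} (hκ : 0 < κ) (hκπ : κ < Real.pi)
    {f f' : ℝ → ℝ} (hf : ∀ x, HasDerivAt f (f' x) x) (hf' : Continuous f')
    (hmean : ∫ x in (0:ℝ)..1, f x = 0) :
    κ ^ 2 * ∫ x in (0:ℝ)..1, f x ^ 2 ≤ ∫ x in (0:ℝ)..1, f' x ^ 2 := by
  have hfc : Continuous f := continuous_iff_continuousAt.2 fun x => (hf x).continuousAt
  set G : ℝ → ℝ := fun x => ∫ y in (0:ℝ)..x, f y with hGdef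
  have hG : ∀ x, HasDerivAt G (f x) x := fun x => hfc.integral_hasStrictDerivAt 0 x |>.hasDerivAt
  have hGc : Continuous G := continuous_iff_continuousAt.2 fun x => (hG x).continuousAt
  have h0 : G 0 = 0 := by simp [hGdef]
  have hW := sq_mul_integral_sq_le_of_eq_zero hκ hκπ hG hfc h0 hmean
  have hparts := intervalIntegral.integral_eq_sub_of_hasDerivAt
    (f := fun x => G x * f x) (a := 0) (b := 1) (fun x _ => (hG x).mul (hf x))
    ((by fun_prop : Continuous _).intervalIntegrable _ _)
  have h1 : G 1 = 0 := hmean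
  have hi : ∀ {φ : ℝ → ℝ}, Continuous φ → IntervalIntegrable φ volume 0 1 :=
    fun h => h.intervalIntegrable _ _
  rw [intervalIntegral.integral_add (hi (by fun_prop)) (hi (by fun_prop))] at hparts
  have hnn : 0 ≤ ∫ x in (0:ℝ)..1, (f' x + κ ^ 2 * G x) ^ 2 :=
    intervalIntegral.integral_nonneg zero_le_one fun _ _ => sq_nonneg _
  have hexp : ∫ x in (0:ℝ)..1, (f' x + κ ^ 2 * G x) ^ 2 =
      (∫ x in (0:ℝ)..1, f' x ^ 2) + 2 * κ ^ 2 * (∫ x in (0:ℝ)..1, G x * f' x)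
        + κ ^ 4 * ∫ x in (0:ℝ)..1, G x ^ 2 := by
    rw [← intervalIntegral.integral_const_mul, ← intervalIntegral.integral_const_mul,
      ← intervalIntegral.integral_add (hi (by fun_prop)) (hi (by fun_prop)),
      ← intervalIntegral.integral_add (hi (by fun_prop)) (hi (by fun_prop))]
    congr 1 with x
    ring
  simp only [h0, h1, ← pow_two] at hparts
  nlinarith [mul_le_mul_of_nonneg_left hW (sq_nonneg κ)]

theorem hasDerivAt_integral_of_continuous_deriv {F F' : ℝ → ℝ → ℝ}
    (hF : Continuous F.uncurry) (hF' : Continuous F'.uncurry)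
    (hd : ∀ t s, HasDerivAt (fun t => F t s) (F' t s) t) (a b t : ℝ) :
    HasDerivAt (fun t => ∫ s in a..b, F t s) (∫ s in a..b, F' t s) t := by
  obtain ⟨C, hC⟩ := ((isCompact_Icc (a := t - 1) (b := t + 1)).prod
    (isCompact_uIcc (a := a) (b := b))).exists_bound_of_continuousOn hF'.continuousOn
  refine (intervalIntegral.hasDerivAt_integral_of_dominated_loc_of_deriv_le
    (s := Set.Icc (t - 1) (t + 1)) (bound := fun _ => C)
    (Icc_mem_nhds (by linarith) (by linarith)) ?_ ?_ ?_ ?_ ?_ ?_).2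
  · exact .of_forall fun x => (hF.uncurry_left x).aestronglyMeasurable
  · exact (hF.uncurry_left t).intervalIntegrable _ _
  · exact (hF'.uncurry_left t).aestronglyMeasurable
  · exact .of_forall fun s hs x hx => hC (x, s) ⟨hx, Set.uIoc_subset_uIcc hs⟩
  · exact intervalIntegrable_const
  · exact .of_forall fun s _ x _ => hd x s

/-- A trace inequality on the unit square for functions that are constant on the side `t = 0` and
have mean zero on the opposite side. -/
theorem mul_integral_sq_le_of_collapse {κ : ℝ} (hκ : 0 < κ) (hκπ : κ < Real.pi)
    {g p q : ℝ → ℝ → ℝ} (hp : Continuous p.uncurry) (hq : Continuous q.uncurry)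
    (hg : Continuous g.uncurry)
    (hgs : ∀ t s, HasDerivAt (fun s => g t s) (t * p t s) s)
    (hgt : ∀ t s, HasDerivAt (fun t => g t s) (q t s) t)
    (hmean : ∫ s in (0:ℝ)..1, g 1 s = 0) :
    κ * ∫ s in (0:ℝ)..1, g 1 s ^ 2 ≤
      ∫ t in (0:ℝ)..1, ∫ s in (0:ℝ)..1, t * (p t s ^ 2 + q t s ^ 2) := by
  have hi : ∀ {φ : ℝ → ℝ}, Continuous φ → IntervalIntegrable φ volume 0 1 :=
    fun h => h.intervalIntegrable _ _
  have hgl : ∀ t, Continuous (g t) := fun t => hg.uncurry_left t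
  have hpl : ∀ t, Continuous (p t) := fun t => hp.uncurry_left t
  have hql : ∀ t, Continuous (q t) := fun t => hq.uncurry_left t
  set m : ℝ → ℝ := fun t => ∫ s in (0:ℝ)..1, g t s with hm
  set V : ℝ → ℝ := fun t => (∫ s in (0:ℝ)..1, g t s ^ 2) - m t ^ 2 with hV
  have hVd : ∀ t, HasDerivAt V (2 * ∫ s in (0:ℝ)..1, (g t s - m t) * q t s) t := by
    intro t
    have h1 := hasDerivAt_integral_of_continuous_deriv (F := fun t s => g t s ^ 2)
      (F' := fun t s => 2 * g t s * q t s) (by fun_prop) (by fun_prop)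
      (fun t s => ((hgt t s).pow 2).congr_deriv (by simp)) 0 1 t
    have h2 := hasDerivAt_integral_of_continuous_deriv hg hq hgt 0 1 t
    refine (h1.sub (h2.pow 2)).congr_deriv ?_
    have : ∀ s, (g t s - m t) * q t s = g t s * q t s - m t * q t s := fun s => by ring
    simp only [this, mul_assoc]
    rw [intervalIntegral.integral_sub (hi (by fun_prop)) (hi (by fun_prop)),
      intervalIntegral.integral_const_mul, intervalIntegral.integral_const_mul]
    simp [hm]
    ring
  set W : ℝ → ℝ := fun t => ∫ s in (0:ℝ)..1, t * (p t s ^ 2 + q t s ^ 2) with hW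
  have hWc : Continuous W := by fun_prop
  have hle : ∀ t ∈ Set.Ioo (0:ℝ) 1,
      2 * ∫ s in (0:ℝ)..1, (g t s - m t) * q t s ≤ κ⁻¹ * W t := by
    intro t ht
    have ht0 := ht.1
    have hPoin := sq_mul_integral_sq_le_of_integral_eq_zero hκ hκπ
      (f := fun s => g t s - m t) (fun s => (hgs t s).sub_const _) (by fun_prop) (by
        rw [intervalIntegral.integral_sub (hi (by fun_prop)) (hi (by fun_prop))]
        simp [hm])
    have hY : 2 * ∫ s in (0:ℝ)..1, (g t s - m t) * q t s ≤
        κ / t * (∫ s in (0:ℝ)..1, (g t s - m t) ^ 2) + t / κ * ∫ s in (0:ℝ)..1, q t s ^ 2 := by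
      rw [← intervalIntegral.integral_const_mul, ← intervalIntegral.integral_const_mul,
        ← intervalIntegral.integral_const_mul,
        ← intervalIntegral.integral_add (hi (by fun_prop)) (hi (by fun_prop))]
      refine intervalIntegral.integral_mono zero_le_one (hi (by fun_prop)) (hi (by fun_prop))
        fun s => ?_
      have : κ / t * (g t s - m t) ^ 2 + t / κ * q t s ^ 2 - 2 * ((g t s - m t) * q t s)
          = (κ * (g t s - m t) - t * q t s) ^ 2 / (κ * t) := by
        field_simp
        ring
      have : 0 ≤ (κ * (g t s - m t) - t * q t s) ^ 2 / (κ * t) := by positivity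
      linarith
    have hWt : W t = t * (∫ s in (0:ℝ)..1, p t s ^ 2) + t * ∫ s in (0:ℝ)..1, q t s ^ 2 := by
      rw [← intervalIntegral.integral_const_mul, ← intervalIntegral.integral_const_mul,
        ← intervalIntegral.integral_add (hi (by fun_prop)) (hi (by fun_prop))]
      simp only [hW, mul_add]
    simp only [mul_pow, intervalIntegral.integral_const_mul] at hPoin
    refine hY.trans ?_
    rw [hWt]
    have : κ / t * ∫ s in (0:ℝ)..1, (g t s - m t) ^ 2 ≤
        κ⁻¹ * (t * ∫ s in (0:ℝ)..1, p t s ^ 2) := by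
      have := mul_le_mul_of_nonneg_left hPoin (by positivity : 0 ≤ (κ * t)⁻¹)
      field_simp at this ⊢
      linarith
    calc _ ≤ _ := add_le_add_left this _
      _ = _ := by ring
  have hVc : Continuous V := continuous_iff_continuousAt.2 fun x => (hVd x).continuousAt
  have hmain := intervalIntegral.sub_le_integral_of_hasDeriv_right_of_le zero_le_one
    hVc.continuousOn (fun t _ => (hVd t).hasDerivWithinAt)
    (hWc.const_mul κ⁻¹ |>.integrableOn_Icc) hle
  have hconst : ∀ s, g 0 s = g 0 0 := fun s =>
    is_const_of_deriv_eq_zero (fun s => (hgs 0 s).differentiableAt)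
      (fun s => by simpa using (hgs 0 s).deriv) s 0
  have hV0 : V 0 = 0 := by simp [hV, hm, hconst]
  have hV1 : V 1 = ∫ s in (0:ℝ)..1, g 1 s ^ 2 := by simp [hV, hm, hmean]
  rw [hV0, hV1, intervalIntegral.integral_const_mul, sub_zero] at hmain
  calc _ ≤ κ * (κ⁻¹ * ∫ t in (0:ℝ)..1, W t) := by gcongr
    _ = _ := by field_simp

theorem setIntegral_coordinates_eq {I J : Set ℝ}
    (hI : I ⊆ Set.Icc 0 1) (hJ : J ⊆ Set.Icc 0 1) {φ : ℝ → ℝ → ℝ} (hφ : Continuous φ.uncurry) :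
    ∫ z in {z : ℝ² | z 0 ∈ I ∧ z 1 ∈ J}, φ (z 0) (z 1) = ∫ t in I, ∫ s in J, φ t s := by
  have he := (volume_preserving_finTwoArrow ℝ).comp
    (EuclideanSpace.volume_preserving_symm_measurableEquiv_toLp (Fin 2))
  have hemb := (((MeasurableEquiv.toLp 2 (Fin 2 → ℝ)).symm).trans
    (MeasurableEquiv.finTwoArrow (α := ℝ))).measurableEmbedding
  have h := he.setIntegral_preimage_emb hemb φ.uncurry (I ×ˢ J)
  have hint : IntegrableOn φ.uncurry (I ×ˢ J) (volume.prod volume) :=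
    (hφ.continuousOn.integrableOn_compact (isCompact_Icc.prod isCompact_Icc)).mono_set
      (Set.prod_mono hI hJ)
  exact h.trans (setIntegral_prod _ hint)

/-- The map collapsing the side `t = 0` of the unit square to the point `P`; its image is the
triangle with vertices `P`, `P + b` and `P + b + a`. -/
def collapse (P b a z : ℝ²) : ℝ² := P + z 0 • (b + z 1 • a)

theorem exists_hasFDerivAt_collapse (P b a z : ℝ²) :
    ∃ A : ℝ² →L[ℝ] ℝ², HasFDerivAt (collapse P b a) A z ∧
      A.det = z 0 * (b 0 * a 1 - b 1 * a 0) := by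
  set M : Matrix (Fin 2) (Fin 2) ℝ :=
    !![b 0 + z 1 * a 0, z 0 * a 0; b 1 + z 1 * a 1, z 0 * a 1] with hM
  refine ⟨LinearMap.toContinuousLinearMap (Matrix.toLin (EuclideanSpace.basisFun (Fin 2) ℝ).toBasis
    (EuclideanSpace.basisFun (Fin 2) ℝ).toBasis M), ?_, ?_⟩
  · have h0 : HasFDerivAt (fun z : ℝ² => z 0) (EuclideanSpace.proj (𝕜 := ℝ) (0 : Fin 2)) z :=
      (EuclideanSpace.proj (𝕜 := ℝ) (0 : Fin 2) : ℝ² →L[ℝ] ℝ).hasFDerivAt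
    have h1 : HasFDerivAt (fun z : ℝ² => z 1) (EuclideanSpace.proj (𝕜 := ℝ) (1 : Fin 2)) z :=
      (EuclideanSpace.proj (𝕜 := ℝ) (1 : Fin 2) : ℝ² →L[ℝ] ℝ).hasFDerivAt
    refine ((h0.smul ((h1.smul_const a).const_add b)).const_add P).congr_fderiv ?_
    ext w i
    fin_cases i <;>
    simp [hM, Matrix.toLin_apply, Matrix.mulVec, dotProduct, Fin.sum_univ_two] <;> ring
  · rw [LinearMap.det_toContinuousLinearMap, LinearMap.det_toLin, hM, Matrix.det_fin_two_of]
    ring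

theorem injOn_collapse {P b a : ℝ²} (hD : b 0 * a 1 - b 1 * a 0 ≠ 0) :
    Set.InjOn (collapse P b a) {z | z 0 ≠ 0} := by
  intro z hz w _ h
  have h0 := congrArg (fun x : ℝ² => x 0) h
  have h1 := congrArg (fun x : ℝ² => x 1) h
  simp [collapse] at h0 h1 hz
  have hzw : z 0 = w 0 := mul_right_cancel₀ hD (by linear_combination a 1 * h0 - a 0 * h1)
  have hzw' : z 1 = w 1 := by
    refine mul_left_cancel₀ hz (mul_right_cancel₀ hD ?_)
    rw [← hzw] at h0 h1
    linear_combination b 0 * h1 - b 1 * h0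
  ext i
  fin_cases i
  exacts [hzw, hzw']

theorem collapse_mem_convexHull (P Q R : ℝ²) {z : ℝ²} (h0 : z 0 ∈ Set.Icc (0:ℝ) 1)
    (h1 : z 1 ∈ Set.Icc (0:ℝ) 1) :
    collapse R (P - R) (Q - P) z ∈ convexHull ℝ {P, Q, R} := by
  have hc := convex_convexHull ℝ ({P, Q, R} : Set ℝ²)
  have hsub := subset_convexHull ℝ ({P, Q, R} : Set ℝ²)
  have hy := hc.add_smul_sub_mem (hsub (by simp)) (hsub (by simp)) h1 (x := P) (y := Q)
  have := hc.add_smul_sub_mem (hsub (by simp)) hy h0 (x := R)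
  convert this using 1
  simp only [collapse]
  module

theorem convexHull_subset_image_collapse (P Q R : ℝ²) :
    convexHull ℝ {P, Q, R} ⊆ collapse R (P - R) (Q - P) ''
      {z | z 0 ∈ Set.Icc (0:ℝ) 1 ∧ z 1 ∈ Set.Icc (0:ℝ) 1} := by
  intro x hx
  rw [show ({P, Q, R} : Set ℝ²) = {R, P, Q} by ext; simp; tauto,
    convexHull_insert (by simp), convexHull_pair, mem_convexJoin] at hx
  obtain ⟨_, rfl, y, hy, hx⟩ := hx
  rw [segment_eq_image'] at hy hx
  obtain ⟨s, hs, rfl⟩ := hy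
  obtain ⟨t, ht, rfl⟩ := hx
  refine ⟨!₂[t, s], ⟨by simpa using ht, by simpa using hs⟩, ?_⟩
  simp [collapse]
  module

theorem measurableSet_coordinates {I J : Set ℝ} (hI : MeasurableSet I) (hJ : MeasurableSet J) :
    MeasurableSet {z : ℝ² | z 0 ∈ I ∧ z 1 ∈ J} :=
  ((by fun_prop : Measurable fun z : ℝ² => z 0) hI).inter
    ((by fun_prop : Measurable fun z : ℝ² => z 1) hJ)

theorem volume_convexHull_triple_le (P Q R : ℝ²) :
    (volume (convexHull ℝ {P, Q, R})).toReal ≤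
      |(P - R) 0 * (Q - P) 1 - (P - R) 1 * (Q - P) 0| / 2 := by
  choose A hA hdet using exists_hasFDerivAt_collapse R (P - R) (Q - P)
  set D := (P - R) 0 * (Q - P) 1 - (P - R) 1 * (Q - P) 0
  set S : Set ℝ² := {z | z 0 ∈ Set.Icc (0:ℝ) 1 ∧ z 1 ∈ Set.Icc (0:ℝ) 1}
  have hS : MeasurableSet S := measurableSet_coordinates measurableSet_Icc measurableSet_Icc
  have hle := (measure_mono (convexHull_subset_image_collapse P Q R)).trans
    (addHaar_image_le_lintegral_abs_det_fderiv volume hS fun z _ => (hA z).hasFDerivWithinAt)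
  have hval : ∫ z in S, |z 0| * |D| = |D| / 2 := by
    rw [setIntegral_coordinates_eq (φ := fun t _ => |t| * |D|) subset_rfl subset_rfl (by fun_prop)]
    simp only [integral_Icc_eq_integral_Ioc]
    have : ∫ t in Set.Ioc (0:ℝ) 1, ∫ _ in Set.Ioc (0:ℝ) 1, |t| * |D|
        = ∫ t in Set.Ioc (0:ℝ) 1, t * |D| :=
      setIntegral_congr_fun measurableSet_Ioc fun t ht => by simp [abs_of_pos ht.1]
    rw [this, ← intervalIntegral.integral_of_le zero_le_one, intervalIntegral.integral_mul_const]
    simp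
    ring
  have hSc : IntegrableOn (fun z : ℝ² => |z 0| * |D|) S := by
    by_contra h
    rw [integral_undef h] at hval
    have : D = 0 := by simpa using hval.symm
    simp [this] at h
  simp only [hdet, abs_mul] at hle
  rw [← ofReal_integral_eq_lintegral_ofReal hSc (.of_forall fun _ => by positivity), hval] at hle
  exact ENNReal.toReal_le_of_le_ofReal (by positivity) hle

theorem isCompact_convexHull_triple (P Q R : ℝ²) :
    IsCompact (convexHull ℝ ({P, Q, R} : Set ℝ²)) :=
  (Set.toFinite _).isCompact_convexHull ℝ

theorem integral_collapse_le_setIntegral_convexHull {P Q R : ℝ²}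
    (hD : (P - R) 0 * (Q - P) 1 - (P - R) 1 * (Q - P) 0 ≠ 0) {f : ℝ² → ℝ} (hf : Continuous f)
    (hf0 : ∀ x, 0 ≤ f x) :
    |(P - R) 0 * (Q - P) 1 - (P - R) 1 * (Q - P) 0| *
      (∫ t in (0:ℝ)..1, ∫ s in (0:ℝ)..1, t * f (R + t • (P - R + s • (Q - P)))) ≤
      ∫ x in convexHull ℝ {P, Q, R}, f x := by
  choose A hA hdet using exists_hasFDerivAt_collapse R (P - R) (Q - P)
  set D := (P - R) 0 * (Q - P) 1 - (P - R) 1 * (Q - P) 0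
  set S : Set ℝ² := {z | z 0 ∈ Set.Ioo (0:ℝ) 1 ∧ z 1 ∈ Set.Ioo (0:ℝ) 1}
  have hS : MeasurableSet S := measurableSet_coordinates measurableSet_Ioo measurableSet_Ioo
  have hsub : collapse R (P - R) (Q - P) '' S ⊆ convexHull ℝ {P, Q, R} := by
    rintro _ ⟨z, hz, rfl⟩
    exact collapse_mem_convexHull P Q R (Set.Ioo_subset_Icc_self hz.1)
      (Set.Ioo_subset_Icc_self hz.2)
  have himg := integral_image_eq_integral_abs_det_fderiv_smul volume hS
    (fun z _ => (hA z).hasFDerivWithinAt)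
    ((injOn_collapse hD).mono fun z hz => hz.1.1.ne') f
  have hmono : ∫ x in collapse R (P - R) (Q - P) '' S, f x ≤ ∫ x in convexHull ℝ {P, Q, R}, f x :=
    setIntegral_mono_set (hf.continuousOn.integrableOn_compact (isCompact_convexHull_triple P Q R))
      (.of_forall hf0) hsub.eventuallyLE
  refine le_trans (le_of_eq ?_) (himg.symm.trans_le hmono)
  have : ∫ z in S, |(A z).det| • f (collapse R (P - R) (Q - P) z) =
      ∫ z in S, (fun t s => |D| * (t * f (R + t • (P - R + s • (Q - P))))) (z 0) (z 1) :=
    setIntegral_congr_fun hS fun z hz => by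
      simp [hdet, abs_mul, abs_of_pos hz.1.1, collapse]
      ring
  rw [this]
  refine Eq.trans ?_ (setIntegral_coordinates_eq
    (φ := fun t s => |D| * (t * f (R + t • (P - R + s • (Q - P)))))
    Set.Ioo_subset_Icc_self Set.Ioo_subset_Icc_self (by fun_prop)).symm
  simp only [← integral_Ioc_eq_integral_Ioo, ← intervalIntegral.integral_of_le zero_le_one]
  simp only [intervalIntegral.integral_const_mul]

theorem volume_convexHull_triple_pos {P Q R : ℝ²} (h : AffineIndependent ℝ ![P, Q, R]) :
    0 < (volume (convexHull ℝ {P, Q, R})).toReal := by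
  have htop : affineSpan ℝ ({P, Q, R} : Set ℝ²) = ⊤ := by
    have := h.affineSpan_eq_top_iff_card_eq_finrank_add_one.2 (by simp)
    rwa [Matrix.range_cons, Matrix.range_cons, Matrix.range_cons_empty] at this
  have hne := interior_convexHull_nonempty_iff_affineSpan_eq_top.2 htop
  exact ENNReal.toReal_pos
    ((isOpen_interior.measure_pos volume hne).trans_le (measure_mono interior_subset)).ne'
    (isCompact_convexHull_triple P Q R).measure_lt_top.ne

/-- A function of class `Cⁿ` on a neighbourhood of a closed set agrees near that set with a globally
`Cⁿ` function. -/
theorem exists_contDiff_eventuallyEq_of_contDiffOn {E : Type*} [NormedAddCommGroup E]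
    [NormedSpace ℝ E] [FiniteDimensional ℝ E] {n : ℕ∞} {u : E → ℝ} {K U : Set E}
    (hU : IsOpen U) (hK : IsClosed K) (hKU : K ⊆ U) (hu : ContDiffOn ℝ n u U) :
    ∃ v : E → ℝ, ContDiff ℝ n v ∧ ∀ x ∈ K, v =ᶠ[nhds x] u := by
  obtain ⟨χ, h0, h1, -⟩ := exists_contMDiffMap_zero_one_nhds_of_isClosed (n := n)
    (modelWithCornersSelf ℝ E) hU.isClosed_compl hK
    (Set.disjoint_left.2 fun x hx hxK => hx (hKU hxK))
  have hχ : ContDiff ℝ n χ := χ.contMDiff.contDiff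
  refine ⟨fun x => χ x * u x, contDiff_iff_contDiffAt.2 fun x => ?_, fun x hx => ?_⟩
  · by_cases hx : x ∈ U
    · exact hχ.contDiffAt.mul (hu.contDiffAt (hU.mem_nhds hx))
    · refine (contDiffAt_const (c := (0:ℝ))).congr_of_eventuallyEq ?_
      filter_upwards [mem_nhdsSet_iff_forall.1 h0 x hx] with y hy
      simp_all
  · filter_upwards [mem_nhdsSet_iff_forall.1 h1 x hx] with y hy
    simp_all

/-- The trace inequality on a triangle, with constant `1 / κ` for any `κ < π`, for a globally `C¹`
function of mean zero on the edge `[P, Q]`. -/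
theorem mul_integral_sq_le_setIntegral_convexHull {κ : ℝ} (hκ : 0 < κ) (hκπ : κ < Real.pi)
    {P Q R : ℝ²} (h : AffineIndependent ℝ ![P, Q, R]) {v : ℝ² → ℝ} (hv : ContDiff ℝ 1 v)
    (hmean : ∫ s in (0:ℝ)..1, v (P + s • (Q - P)) = 0) :
    κ * (volume (convexHull ℝ {P, Q, R})).toReal * ∫ s in (0:ℝ)..1, v (P + s • (Q - P)) ^ 2 ≤
      Metric.diam (convexHull ℝ ({P, Q, R} : Set ℝ²)) ^ 2 *
        ∫ x in convexHull ℝ {P, Q, R}, ‖fderiv ℝ v x‖ ^ 2 := by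
  have hvc : Continuous v := hv.continuous
  have hdvc : Continuous (fderiv ℝ v) := hv.continuous_fderiv one_ne_zero
  have hvd : ∀ x, HasFDerivAt v (fderiv ℝ v x) x := fun x =>
    (hv.differentiable one_ne_zero x).hasFDerivAt
  set H := Metric.diam (convexHull ℝ ({P, Q, R} : Set ℝ²))
  set b := P - R with hb
  set a := Q - P with ha
  set X : ℝ → ℝ → ℝ² := fun t s => R + t • (b + s • a) with hX
  have hbound : ∀ x ∈ convexHull ℝ {P, Q, R}, ∀ y ∈ convexHull ℝ {P, Q, R}, ‖x - y‖ ≤ H :=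
    fun x hx y hy => by
      rw [← dist_eq_norm]
      exact Metric.dist_le_diam_of_mem (isCompact_convexHull_triple P Q R).isBounded hx hy
  have hsub := subset_convexHull ℝ ({P, Q, R} : Set ℝ²)
  have haH : ‖a‖ ≤ H := hbound Q (hsub (by simp)) P (hsub (by simp))
  have hbH : ∀ s ∈ Set.Icc (0:ℝ) 1, ‖b + s • a‖ ≤ H := fun s hs => by
    have hy := (convex_convexHull ℝ ({P, Q, R} : Set ℝ²)).add_smul_sub_mem
      (hsub (by simp)) (hsub (by simp)) hs (x := P) (y := Q)
    convert hbound _ hy R (hsub (by simp)) using 2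
    rw [hb, ha]
    abel
  have hX1 : ∀ s, X 1 s = P + s • a := fun s => by
    simp only [hX, hb]
    module
  have hcollapse := mul_integral_sq_le_of_collapse hκ hκπ (g := fun t s => v (X t s))
    (p := fun t s => fderiv ℝ v (X t s) a) (q := fun t s => fderiv ℝ v (X t s) (b + s • a))
    (by fun_prop) (by fun_prop) (by fun_prop)
    (fun t s => by
      have hXs : HasDerivAt (fun s => X t s) (t • a) s := by
        exact (((((hasDerivAt_id s).smul_const a).const_add b).const_smul t).const_add R).congr_deriv
          (by simp)
      exact ((hvd (X t s)).comp_hasDerivAt s hXs).congr_deriv (by simp))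
    (fun t s => by
      have hXt : HasDerivAt (fun t => X t s) (b + s • a) t := by
        exact (((hasDerivAt_id t).smul_const (b + s • a)).const_add R).congr_deriv (by simp)
      exact (hvd (X t s)).comp_hasDerivAt t hXt)
    (by simpa only [hX1] using hmean)
  simp only [hX1] at hcollapse
  have hvol := volume_convexHull_triple_le P Q R
  have hpos := volume_convexHull_triple_pos h
  have hD : (P - R) 0 * (Q - P) 1 - (P - R) 1 * (Q - P) 0 ≠ 0 := fun h0 => by
    rw [h0] at hvol
    simp at hvol
    linarith
  have hint := integral_collapse_le_setIntegral_convexHull hD (f := fun x => ‖fderiv ℝ v x‖ ^ 2)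
    (by fun_prop) (fun _ => by positivity)
  set I := ∫ t in (0:ℝ)..1, ∫ s in (0:ℝ)..1, t * ‖fderiv ℝ v (X t s)‖ ^ 2 with hI
  have hgrad : ∫ t in (0:ℝ)..1, ∫ s in (0:ℝ)..1,
      t * (fderiv ℝ v (X t s) a ^ 2 + fderiv ℝ v (X t s) (b + s • a) ^ 2) ≤ 2 * H ^ 2 * I := by
    have hsq : ∀ x y, ‖y‖ ≤ H → fderiv ℝ v x y ^ 2 ≤ H ^ 2 * ‖fderiv ℝ v x‖ ^ 2 := fun x y hy => by
      rw [← mul_pow, ← sq_abs, ← Real.norm_eq_abs, mul_comm]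
      gcongr
      exact (fderiv ℝ v x).le_of_opNorm_le_of_le le_rfl hy
    rw [hI, ← intervalIntegral.integral_const_mul]
    refine intervalIntegral.integral_mono_on zero_le_one
      ((by fun_prop : Continuous _).intervalIntegrable _ _)
      ((by fun_prop : Continuous _).intervalIntegrable _ _) fun t ht => ?_
    rw [← intervalIntegral.integral_const_mul]
    refine intervalIntegral.integral_mono_on zero_le_one
      ((by fun_prop : Continuous _).intervalIntegrable _ _)
      ((by fun_prop : Continuous _).intervalIntegrable _ _) fun s hs => ?_
    calc _ ≤ t * (H ^ 2 * ‖fderiv ℝ v (X t s)‖ ^ 2 + H ^ 2 * ‖fderiv ℝ v (X t s)‖ ^ 2) :=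
          mul_le_mul_of_nonneg_left (add_le_add (hsq _ _ haH) (hsq _ _ (hbH s hs))) ht.1
      _ = _ := by ring
  have hI0 : 0 ≤ I := intervalIntegral.integral_nonneg zero_le_one fun t ht =>
    intervalIntegral.integral_nonneg zero_le_one fun s _ => mul_nonneg ht.1 (by positivity)
  calc _ = (volume (convexHull ℝ {P, Q, R})).toReal *
        (κ * ∫ s in (0:ℝ)..1, v (P + s • a) ^ 2) := by ring
    _ ≤ (volume (convexHull ℝ {P, Q, R})).toReal * (2 * H ^ 2 * I) :=
        mul_le_mul_of_nonneg_left (hcollapse.trans hgrad) hpos.le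
    _ ≤ |(P - R) 0 * (Q - P) 1 - (P - R) 1 * (Q - P) 0| / 2 * (2 * H ^ 2 * I) := by gcongr
    _ = H ^ 2 * (|(P - R) 0 * (Q - P) 1 - (P - R) 1 * (Q - P) 0| * I) := by ring
    _ ≤ _ := by gcongr

/-- Theorem 4.1 of the paper (explicit trace theorem on a triangle): if `u` is
continuously differentiable on a neighborhood of the triangle `K` with vertices
`P₁, P₂, P₃` and has mean zero on the edge `e = [P₁, P₂]`, then
`‖u‖_{L²(e)} ≤ 0.574 √(|e|/|K|) h_K ‖∇u‖_{L²(K)}`. -/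
theorem explicit_trace_theorem
    (P₁ P₂ P₃ : EuclideanSpace ℝ (Fin 2))
    (hind : AffineIndependent ℝ ![P₁, P₂, P₃])
    (u : EuclideanSpace ℝ (Fin 2) → ℝ)
    (U : Set (EuclideanSpace ℝ (Fin 2))) (hU : IsOpen U)
    (hKU : convexHull ℝ {P₁, P₂, P₃} ⊆ U)
    (hu : ContDiffOn ℝ 1 u U)
    (hmean : (∫ t in (0:ℝ)..1, u (P₁ + t • (P₂ - P₁)) * dist P₁ P₂) = 0) :
    Real.sqrt (∫ t in (0:ℝ)..1, u (P₁ + t • (P₂ - P₁)) ^ 2 * dist P₁ P₂)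
      ≤ 0.574
          * Real.sqrt (dist P₁ P₂ / (volume (convexHull ℝ {P₁, P₂, P₃})).toReal)
          * Metric.diam (convexHull ℝ ({P₁, P₂, P₃} : Set (EuclideanSpace ℝ (Fin 2))))
          * Real.sqrt (∫ x in convexHull ℝ {P₁, P₂, P₃}, ‖gradient u x‖ ^ 2) := by
  obtain ⟨v, hv, hvu⟩ := exists_contDiff_eventuallyEq_of_contDiffOn (n := 1) hU
    (isCompact_convexHull_triple P₁ P₂ P₃).isClosed hKU (by exact_mod_cast hu)
  have hsub := subset_convexHull ℝ ({P₁, P₂, P₃} : Set ℝ²)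
  have hedge : ∀ t ∈ Set.uIcc (0:ℝ) 1, u (P₁ + t • (P₂ - P₁)) = v (P₁ + t • (P₂ - P₁)) := by
    intro t ht
    rw [Set.uIcc_of_le zero_le_one] at ht
    exact (hvu _ ((convex_convexHull ℝ _).add_smul_sub_mem
      (hsub (by simp)) (hsub (by simp)) ht)).self_of_nhds.symm
  have hgrad : ∫ x in convexHull ℝ {P₁, P₂, P₃}, ‖gradient u x‖ ^ 2 =
      ∫ x in convexHull ℝ {P₁, P₂, P₃}, ‖fderiv ℝ v x‖ ^ 2 :=
    setIntegral_congr_fun (isCompact_convexHull_triple P₁ P₂ P₃).measurableSet fun x hx => by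
      simp [gradient, (hvu x hx).fderiv_eq]
  have hL : 0 < dist P₁ P₂ := dist_pos.2 fun h => by
    simpa using hind.injective.ne (by decide : (0 : Fin 3) ≠ 1) h
  have hvmean : ∫ t in (0:ℝ)..1, v (P₁ + t • (P₂ - P₁)) = 0 := by
    rw [intervalIntegral.integral_mul_const] at hmean
    rw [← intervalIntegral.integral_congr hedge]
    exact (mul_eq_zero.1 hmean).resolve_right hL.ne'
  have hsq : ∫ t in (0:ℝ)..1, u (P₁ + t • (P₂ - P₁)) ^ 2 * dist P₁ P₂ =
      (∫ t in (0:ℝ)..1, v (P₁ + t • (P₂ - P₁)) ^ 2) * dist P₁ P₂ := by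
    rw [intervalIntegral.integral_mul_const]
    congr 1
    exact intervalIntegral.integral_congr fun t ht => by simp only [hedge t ht]
  have hmain := mul_integral_sq_le_setIntegral_convexHull (κ := 3.1) (by norm_num)
    (by linarith [Real.pi_gt_d2]) hind (by exact_mod_cast hv) hvmean
  have hK := volume_convexHull_triple_pos hind
  rw [hsq, hgrad]
  set A := (volume (convexHull ℝ {P₁, P₂, P₃})).toReal
  set J := ∫ x in convexHull ℝ {P₁, P₂, P₃}, ‖fderiv ℝ v x‖ ^ 2
  set H := Metric.diam (convexHull ℝ ({P₁, P₂, P₃} : Set ℝ²))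
  set S := ∫ t in (0:ℝ)..1, v (P₁ + t • (P₂ - P₁)) ^ 2
  have hH : 0 ≤ H := Metric.diam_nonneg
  have hJ : 0 ≤ J := integral_nonneg fun _ => by positivity
  refine Real.sqrt_le_iff.2 ⟨by positivity, ?_⟩
  rw [mul_pow, mul_pow, mul_pow, Real.sq_sqrt (by positivity), Real.sq_sqrt hJ]
  have hS : S ≤ 0.574 ^ 2 * H ^ 2 * J / A := by
    rw [le_div_iff₀ hK]
    nlinarith [mul_nonneg (sq_nonneg H) hJ]
  calc S * dist P₁ P₂ ≤ 0.574 ^ 2 * H ^ 2 * J / A * dist P₁ P₂ := by gcongr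
    _ = _ := by ring
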